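/- For every f ∈ I(X), the right translation r_f : I(X) → R_f, r_f(g) = g ∘ f, is an open map, where I(X) carries τ_pp and R_f = {g ∘ f : g ∈ I(X)} carries the subspace topology inherited from τ_pp. -/

import Mathlib

open TopologicalSpace Filter

/-- A partial bijection on `X`, represented by its graph. -/
structure PartialBij (X : Type*) where
  graph : Set (X × X)
  functional : ∀ ⦃x y y'⦄, (x, y) ∈ graph → (x, y') ∈ graph → y = y'
  coinjective : ∀ ⦃x x' y⦄, (x, y) ∈ graph → (x', y) ∈ graph → x = x'

namespace PartialBij

variable {X : Type*}

/-- Composition `f ∘ g` of partial bijections. -/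
def comp (f g : PartialBij X) : PartialBij X where
  graph := {p | ∃ y, (p.1, y) ∈ g.graph ∧ (y, p.2) ∈ f.graph}
  functional := by
    rintro x y y' ⟨z, hz1, hz2⟩ ⟨z', hz1', hz2'⟩
    obtain rfl := g.functional hz1 hz1'
    exact f.functional hz2 hz2'
  coinjective := by
    rintro x x' y ⟨z, hz1, hz2⟩ ⟨z', hz1', hz2'⟩
    obtain rfl := f.coinjective hz2 hz2'
    exact g.coinjective hz1 hz1'

/-- Inversion `f ↦ f⁻¹` of partial bijections. -/
def inv (f : PartialBij X) : PartialBij X where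
  graph := {p | (p.2, p.1) ∈ f.graph}
  functional := fun _ _ _ h h' => f.coinjective h h'
  coinjective := fun _ _ _ h h' => f.functional h h'

/-- Domain of a partial bijection. -/
def dom (f : PartialBij X) : Set X := {x | ∃ y, (x, y) ∈ f.graph}

/-- Image of a partial bijection. -/
def im (f : PartialBij X) : Set X := {y | ∃ x, (x, y) ∈ f.graph}

/-- `v x y = {f : x ∈ dom f and f(x) = y}`. -/
def v (x y : X) : Set (PartialBij X) := {f | (x, y) ∈ f.graph}

/-- `w₁ x = {f : x ∉ dom f}`. -/
def w1 (x : X) : Set (PartialBij X) := {f | x ∉ f.dom}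

/-- `w₂ y = {f : y ∉ im f}`. -/
def w2 (y : X) : Set (PartialBij X) := {f | y ∉ f.im}

/-- The topology generated by the sets `v x y`. -/
def tau0 (X : Type*) : TopologicalSpace (PartialBij X) :=
  generateFrom {s | ∃ x y, s = v x y}

/-- The topology generated by the sets `v x y` and `w₁ x`. -/
def tau1 (X : Type*) : TopologicalSpace (PartialBij X) :=
  generateFrom ({s | ∃ x y, s = v x y} ∪ {s | ∃ x, s = w1 x})

/-- The topology generated by the sets `v x y` and `w₂ y`. -/
def tau2 (X : Type*) : TopologicalSpace (PartialBij X) :=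
  generateFrom ({s | ∃ x y, s = v x y} ∪ {s | ∃ y, s = w2 y})

/-- The partial product topology, generated by the sets `v x y`, `w₁ x` and `w₂ y`. -/
def taupp (X : Type*) : TopologicalSpace (PartialBij X) :=
  generateFrom ({s | ∃ x y, s = v x y} ∪ {s | ∃ x, s = w1 x} ∪ {s | ∃ y, s = w2 y})

/-- The partial identity `1_A` on `A ⊆ X`. -/
def partialId (A : Set X) : PartialBij X where
  graph := {p | p.1 ∈ A ∧ p.1 = p.2}
  functional := by rintro x y y' ⟨_, h⟩ ⟨_, h'⟩; exact h.symm.trans h'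
  coinjective := by rintro x x' y ⟨_, h⟩ ⟨_, h'⟩; exact h.trans h'.symm

/-- The product (Cantor) topology on the power set `2^X`. -/
def cantorTop (X : Type*) : TopologicalSpace (Set X) :=
  generateFrom ({s | ∃ x, s = {A : Set X | x ∈ A}} ∪ {s | ∃ x, s = {A : Set X | x ∉ A}})

open Classical in
/-- Evaluation of a partial bijection at a point of its domain (with junk value `x`
  outside of the domain). -/
noncomputable def evalAt (x : X) (f : PartialBij X) : X :=
  if h : x ∈ f.dom then h.choose else x

end PartialBij

namespace PartialBij

theorem ext_graph {X : Type*} {f g : PartialBij X}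
    (h : ∀ x y, (x, y) ∈ f.graph ↔ (x, y) ∈ g.graph) : f = g := by
  cases f; cases g
  congr
  ext ⟨x, y⟩
  exact h x y

/-- The section of `r_f` through `k`: `h ↦ h ∘ f⁻¹` extended by the part of `k` lying outside
`im f × im h`. -/
def sec {X : Type*} (f k h : PartialBij X) : PartialBij X where
  graph := {p | (∃ z, (z, p.1) ∈ f.graph ∧ (z, p.2) ∈ h.graph) ∨
    (p ∈ k.graph ∧ p.1 ∉ f.im ∧ p.2 ∉ h.im)}
  functional := by
    rintro x y y' (⟨z, h1, h2⟩ | ⟨h1, h2, h3⟩) (⟨z', h1', h2'⟩ | ⟨h1', h2', h3'⟩)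
    · obtain rfl := f.coinjective h1 h1'
      exact h.functional h2 h2'
    · exact absurd ⟨z, h1⟩ h2'
    · exact absurd ⟨z', h1'⟩ h2
    · exact k.functional h1 h1'
  coinjective := by
    rintro x x' y (⟨z, h1, h2⟩ | ⟨h1, h2, h3⟩) (⟨z', h1', h2'⟩ | ⟨h1', h2', h3'⟩)
    · obtain rfl := h.coinjective h2 h2'
      exact f.functional h1 h1'
    · exact absurd ⟨z, h2⟩ h3'
    · exact absurd ⟨z', h2'⟩ h3
    · exact k.coinjective h1 h1'

theorem mem_sec {X : Type*} {f k h : PartialBij X} {x y : X} :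
    (x, y) ∈ (sec f k h).graph ↔ (∃ z, (z, x) ∈ f.graph ∧ (z, y) ∈ h.graph) ∨
      ((x, y) ∈ k.graph ∧ x ∉ f.im ∧ y ∉ h.im) := Iff.rfl

theorem mem_sec_of_mem {X : Type*} {f k h : PartialBij X} {z x y : X} (hz : (z, x) ∈ f.graph) :
    (x, y) ∈ (sec f k h).graph ↔ (z, y) ∈ h.graph := by
  rw [mem_sec]
  constructor
  · rintro (⟨z', h1, h2⟩ | ⟨_, h2, _⟩)
    · obtain rfl := f.coinjective hz h1
      exact h2
    · exact absurd ⟨z, hz⟩ h2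
  · exact fun h => Or.inl ⟨z, hz, h⟩

theorem mem_sec_of_notMem {X : Type*} {f k h : PartialBij X} {x y : X} (hx : x ∉ f.im) :
    (x, y) ∈ (sec f k h).graph ↔ (x, y) ∈ k.graph ∧ y ∉ h.im := by
  rw [mem_sec]
  constructor
  · rintro (⟨z', h1, h2⟩ | ⟨h1, h2, h3⟩)
    · exact absurd ⟨z', h1⟩ hx
    · exact ⟨h1, h3⟩
  · exact fun h => Or.inr ⟨h.1, hx, h.2⟩

theorem sec_comp_self {X : Type*} (f k : PartialBij X) : sec f k (k.comp f) = k := by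
  apply ext_graph
  intro x y
  by_cases hx : x ∈ f.im
  · obtain ⟨z, hz⟩ := hx
    rw [mem_sec_of_mem hz]
    constructor
    · rintro ⟨x', h1, h2⟩
      obtain rfl := f.functional hz h1
      exact h2
    · exact fun h => ⟨x, hz, h⟩
  · rw [mem_sec_of_notMem hx]
    refine ⟨fun h => h.1, fun h => ⟨h, ?_⟩⟩
    rintro ⟨z, x', h1, h2⟩
    obtain rfl := k.coinjective h h2
    exact hx ⟨z, h1⟩

theorem comp_sec {X : Type*} (f k g : PartialBij X) :
    (sec f k (g.comp f)).comp f = g.comp f := by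
  apply ext_graph
  intro x y
  constructor
  · rintro ⟨x', h1, h2⟩
    exact (mem_sec_of_mem h1).1 h2
  · rintro ⟨x', h1, h2⟩
    exact ⟨x', h1, (mem_sec_of_mem h1).2 ⟨x', h1, h2⟩⟩

theorem isOpen_v {X : Type*} (x y : X) : @IsOpen _ (taupp X) (v x y) :=
  isOpen_generateFrom_of_mem (Or.inl (Or.inl ⟨x, y, rfl⟩))

theorem isOpen_w1 {X : Type*} (x : X) : @IsOpen _ (taupp X) (w1 x) :=
  isOpen_generateFrom_of_mem (Or.inl (Or.inr ⟨x, rfl⟩))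

theorem isOpen_w2 {X : Type*} (x : X) : @IsOpen _ (taupp X) (w2 x) :=
  isOpen_generateFrom_of_mem (Or.inr ⟨x, rfl⟩)

theorem continuous_sec {X : Type*} (f k : PartialBij X) :
    @Continuous (Set.range fun g : PartialBij X => g.comp f) (PartialBij X)
      (@instTopologicalSpaceSubtype _ _ (taupp X)) (taupp X) (fun h => sec f k h.1) := by
  letI := taupp X
  have key : ∀ (s : Set (Set.range fun g : PartialBij X => g.comp f)) (t : Set (PartialBij X)),
      IsOpen t → (∀ h, h ∈ s ↔ h.1 ∈ t) → IsOpen s := by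
    intro s t ht hst
    have : s = Subtype.val ⁻¹' t := Set.ext hst
    rw [this]
    exact ht.preimage continuous_subtype_val
  refine continuous_generateFrom_iff.2 ?_
  rintro s ((⟨x, y, rfl⟩ | ⟨x, rfl⟩) | ⟨y, rfl⟩)
  · by_cases hx : x ∈ f.im
    · obtain ⟨z, hz⟩ := hx
      exact key _ (v z y) (isOpen_v z y) fun h => mem_sec_of_mem hz
    · by_cases hk : (x, y) ∈ k.graph
      · exact key _ (w2 y) (isOpen_w2 y) fun h => (mem_sec_of_notMem hx).trans (and_iff_right hk)
      · exact key _ ∅ isOpen_empty fun h =>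
          (mem_sec_of_notMem hx).trans (iff_of_false (fun h => hk h.1) id)
  · by_cases hx : x ∈ f.im
    · obtain ⟨z, hz⟩ := hx
      exact key _ (w1 z) (isOpen_w1 z) fun h =>
        not_congr (exists_congr fun y => mem_sec_of_mem hz)
    · by_cases hk : ∃ y, (x, y) ∈ k.graph
      · obtain ⟨y, hy⟩ := hk
        refine key _ (⋃ z, v z y) (isOpen_iUnion fun z => isOpen_v z y) fun h => ?_
        rw [Set.mem_iUnion]
        constructor
        · intro h1
          by_contra h2
          exact h1 ⟨y, (mem_sec_of_notMem hx).2 ⟨hy, h2⟩⟩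
        · rintro h1 ⟨y', h2⟩
          obtain ⟨h3, h4⟩ := (mem_sec_of_notMem hx).1 h2
          obtain rfl := k.functional hy h3
          exact h4 h1
      · refine key _ Set.univ isOpen_univ fun h => iff_of_true ?_ trivial
        rintro ⟨y, h2⟩
        exact hk ⟨y, ((mem_sec_of_notMem hx).1 h2).1⟩
  · have him : ∀ h : Set.range fun g : PartialBij X => g.comp f,
        y ∈ h.1.im → y ∈ (sec f k h.1).im := by
      rintro ⟨_, g, rfl⟩ ⟨z, x, h1, h2⟩
      exact ⟨x, (mem_sec_of_mem h1).2 ⟨x, h1, h2⟩⟩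
    by_cases hk : ∃ x, (x, y) ∈ k.graph ∧ x ∉ f.im
    · obtain ⟨x, hy, hx⟩ := hk
      refine key _ ∅ isOpen_empty fun h => iff_of_false ?_ id
      intro h1
      exact h1 ⟨x, (mem_sec_of_notMem hx).2 ⟨hy, fun h2 => h1 (him h h2)⟩⟩
    · refine key _ (w2 y) (isOpen_w2 y) fun h => ⟨fun h1 h2 => h1 (him h h2), ?_⟩
      rintro h1 ⟨x, ⟨z, h2, h3⟩ | ⟨h2, h3, h4⟩⟩
      · exact h1 ⟨z, h3⟩
      · exact hk ⟨x, h2, h3⟩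

end PartialBij

open PartialBij in
/-- For every `f ∈ I(X)`, the right translation `r_f : g ↦ g ∘ f` is an open map
from `(I(X), τ_pp)` onto `R_f = {g ∘ f : g ∈ I(X)}` with the subspace topology. -/
theorem right_translation_open {X : Type*} (f : PartialBij X) :
    @IsOpenMap (PartialBij X) (Set.range fun g : PartialBij X => g.comp f)
      (taupp X) (@instTopologicalSpaceSubtype _ _ (taupp X))
      (fun g => ⟨g.comp f, g, rfl⟩) := by
  letI := taupp X
  refine IsOpenMap.of_sections fun k =>
    ⟨fun h => sec f k h.1, (continuous_sec f k).continuousAt, sec_comp_self f k, ?_⟩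
  rintro ⟨_, g, rfl⟩
  exact Subtype.ext (comp_sec f k g)
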